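/- Let D ∈ H⁴ with fundamental invariants J₂, …, J₁₀. There exist g ∈ SO(3) and δ ∈ ℝ with g·D = NF_TI(δ) (i.e., D lies in the closed transversely isotropic stratum) if and only if 98J₄ = 41J₂², 63J₅ = 25J₃J₂, 3430J₃² = 81J₂³, 1372J₆ = 283J₂³, 882J₇ = 275J₂²J₃, 4802J₈ = 165J₂⁴, 12348J₉ = 3025J₂³J₃, and 67228J₁₀ = 1815J₂⁵. Moreover, if in addition J₂ ≠ 0, then δ = 7J₃ / (18J₂). -/

import Mathlib

open Matrix BigOperators

abbrev Mat3 := Matrix (Fin 3) (Fin 3) ℝ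
abbrev T4 := Fin 3 → Fin 3 → Fin 3 → Fin 3 → ℝ

/-- `g ∈ SO(3)`: real orthogonal 3×3 matrix of determinant 1. -/
def IsSO3 (g : Mat3) : Prop := g * gᵀ = 1 ∧ g.det = 1

/-- A harmonic fourth-order tensor: totally symmetric and traceless. -/
def IsHarm (D : T4) : Prop :=
  (∀ i j k l, D i j k l = D j i k l) ∧
  (∀ i j k l, D i j k l = D i k j l) ∧
  (∀ i j k l, D i j k l = D i j l k) ∧
  (∀ i j, ∑ k, D k k i j = 0)

/-- The action of a rotation `g` on a fourth-order tensor. -/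
noncomputable def act (g : Mat3) (D : T4) : T4 := fun i j k l =>
  ∑ p, ∑ q, ∑ r, ∑ s, g i p * g j q * g k r * g l s * D p q r s

/-- `D²`, the square of a fourth-order tensor. -/
noncomputable def sqT (D : T4) : T4 := fun i j k l => ∑ p, ∑ q, D i j p q * D p q k l

/-- `D³`, the cube of a fourth-order tensor. -/
noncomputable def cbT (D : T4) : T4 := fun i j k l => ∑ p, ∑ q, sqT D i j p q * D p q k l

/-- The second-order Boehler covariant `d₂(D) j l = ∑ᵢ (D²) i j i l`. -/
noncomputable def d2 (D : T4) : Mat3 := Matrix.of fun j l => ∑ i, sqT D i j i l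

/-- The second-order covariant `d₃(D) j l = ∑ᵢ (D³) i j i l`. -/
noncomputable def d3 (D : T4) : Mat3 := Matrix.of fun j l => ∑ i, cbT D i j i l

/-- Fundamental invariant `J₂ = tr d₂`. -/
noncomputable def J2 (D : T4) : ℝ := (d2 D).trace
/-- Fundamental invariant `J₃ = tr d₃`. -/
noncomputable def J3 (D : T4) : ℝ := (d3 D).trace
/-- Fundamental invariant `J₄ = tr(d₂²)`. -/
noncomputable def J4 (D : T4) : ℝ := (d2 D * d2 D).trace
/-- Fundamental invariant `J₅ = ∑ (d₂)ᵢⱼ D i j k l (d₂)ₖₗ`. -/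
noncomputable def J5 (D : T4) : ℝ :=
  ∑ i, ∑ j, ∑ k, ∑ l, d2 D i j * D i j k l * d2 D k l
/-- Fundamental invariant `J₆ = tr(d₂³)`. -/
noncomputable def J6 (D : T4) : ℝ := (d2 D * d2 D * d2 D).trace
/-- Fundamental invariant `J₇ = ∑ (d₂²)ᵢⱼ D i j k l (d₂)ₖₗ`. -/
noncomputable def J7 (D : T4) : ℝ :=
  ∑ i, ∑ j, ∑ k, ∑ l, (d2 D * d2 D) i j * D i j k l * d2 D k l
/-- Fundamental invariant `J₈ = ∑ (d₂²)ᵢⱼ (D²) i j k l (d₂)ₖₗ`. -/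
noncomputable def J8 (D : T4) : ℝ :=
  ∑ i, ∑ j, ∑ k, ∑ l, (d2 D * d2 D) i j * sqT D i j k l * d2 D k l
/-- Fundamental invariant `J₉ = ∑ (d₂²)ᵢⱼ D i j k l (d₂²)ₖₗ`. -/
noncomputable def J9 (D : T4) : ℝ :=
  ∑ i, ∑ j, ∑ k, ∑ l, (d2 D * d2 D) i j * D i j k l * (d2 D * d2 D) k l
/-- Fundamental invariant `J₁₀ = ∑ (d₂²)ᵢⱼ (D²) i j k l (d₂²)ₖₗ`. -/
noncomputable def J10 (D : T4) : ℝ :=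
  ∑ i, ∑ j, ∑ k, ∑ l, (d2 D * d2 D) i j * sqT D i j k l * (d2 D * d2 D) k l

/-- The totally symmetric tensor whose value at `(i,j,k,l)` depends only on the
multiset of indices `{i,j,k,l}`. -/
noncomputable def symT (f : Multiset (Fin 3) → ℝ) : T4 := fun i j k l => f {i, j, k, l}

/-- Normal form of a cubic (`[𝕆]`) tensor in `H⁴` with parameter `δ`
(indices `0,1,2` correspond to `1,2,3`). -/
noncomputable def NFcubic (δ : ℝ) : T4 := symT fun m =>
  if m = {0, 0, 0, 0} ∨ m = {1, 1, 1, 1} ∨ m = {2, 2, 2, 2} then 8 * δ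
  else if m = {0, 0, 1, 1} ∨ m = {0, 0, 2, 2} ∨ m = {1, 1, 2, 2} then -(4 * δ)
  else 0

/-- Normal form of a transversely isotropic (`[O(2)]`) tensor in `H⁴` with parameter `δ`. -/
noncomputable def NFti (δ : ℝ) : T4 := symT fun m =>
  if m = {0, 0, 0, 0} ∨ m = {1, 1, 1, 1} then 3 * δ
  else if m = {2, 2, 2, 2} then 8 * δ
  else if m = {0, 0, 1, 1} then δ
  else if m = {0, 0, 2, 2} ∨ m = {1, 1, 2, 2} then -(4 * δ)
  else 0

/-- Normal form of a trigonal (`[𝔻₃]`) tensor in `H⁴` with parameters `δ, σ`. -/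
noncomputable def NFtrig (δ σ : ℝ) : T4 := symT fun m =>
  if m = {0, 0, 0, 0} ∨ m = {1, 1, 1, 1} then 3 * δ
  else if m = {2, 2, 2, 2} then 8 * δ
  else if m = {0, 0, 1, 1} then δ
  else if m = {0, 0, 2, 2} ∨ m = {1, 1, 2, 2} then -(4 * δ)
  else if m = {0, 0, 1, 2} then -σ
  else if m = {1, 1, 1, 2} then σ
  else 0

/-- Normal form of a tetragonal (`[𝔻₄]`) tensor in `H⁴` with parameters `δ, σ`. -/
noncomputable def NFtetra (δ σ : ℝ) : T4 := symT fun m =>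
  if m = {0, 0, 0, 0} ∨ m = {1, 1, 1, 1} then 3 * δ - σ
  else if m = {2, 2, 2, 2} then 8 * δ
  else if m = {0, 0, 1, 1} then δ + σ
  else if m = {0, 0, 2, 2} ∨ m = {1, 1, 2, 2} then -(4 * δ)
  else 0

/-- Normal form of an orthotropic (`[𝔻₂]`) tensor in `H⁴` with parameters `λ₁, λ₂, λ₃`. -/
noncomputable def NForth (l1 l2 l3 : ℝ) : T4 := symT fun m =>
  if m = {0, 0, 0, 0} then -l2 - l3
  else if m = {1, 1, 1, 1} then -l1 - l3
  else if m = {2, 2, 2, 2} then -l1 - l2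
  else if m = {0, 0, 1, 1} then l3
  else if m = {0, 0, 2, 2} then l2
  else if m = {1, 1, 2, 2} then l1
  else 0

open scoped Kronecker

/-- A fourth-order tensor, viewed as a matrix indexed by pairs of indices. -/
def pairMatrix (T : T4) : Matrix (Fin 3 × Fin 3) (Fin 3 × Fin 3) ℝ :=
  Matrix.of fun a b => T a.1 a.2 b.1 b.2

lemma pairMatrix_injective : Function.Injective pairMatrix := by
  intro S T h
  funext i j k l
  exact congrFun (congrFun h (i, j)) (k, l)

lemma pairMatrix_act (g : Mat3) (T : T4) :
    pairMatrix (act g T) = (g ⊗ₖ g) * pairMatrix T * (g ⊗ₖ g)ᵀ := by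
  ext ⟨i, j⟩ ⟨k, l⟩
  simp only [pairMatrix, act, Matrix.mul_apply, Matrix.of_apply, Matrix.transpose_apply,
    Matrix.kroneckerMap_apply, Fintype.sum_prod_type, Fin.sum_univ_three]
  ring

/-- The composition `(S T) i j k l = ∑ S i j p q T p q k l` of fourth-order tensors. -/
noncomputable def compT (S T : T4) : T4 := fun i j k l => ∑ p, ∑ q, S i j p q * T p q k l

lemma pairMatrix_compT (S T : T4) : pairMatrix (compT S T) = pairMatrix S * pairMatrix T := by
  ext ⟨i, j⟩ ⟨k, l⟩
  simp [pairMatrix, compT, Matrix.mul_apply, Fintype.sum_prod_type]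

lemma IsSO3.transpose_mul {g : Mat3} (hg : IsSO3 g) : gᵀ * g = 1 :=
  mul_eq_one_comm.mp hg.1

lemma IsSO3.kronecker_transpose_mul {g : Mat3} (hg : IsSO3 g) : (g ⊗ₖ g)ᵀ * (g ⊗ₖ g) = 1 := by
  rw [← Matrix.kroneckerMap_transpose, ← Matrix.mul_kronecker_mul, hg.transpose_mul,
    Matrix.one_kronecker_one]

lemma compT_act {g : Mat3} (hg : IsSO3 g) (S T : T4) :
    compT (act g S) (act g T) = act g (compT S T) := by
  apply pairMatrix_injective
  simp only [pairMatrix_compT, pairMatrix_act]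
  calc _ = (g ⊗ₖ g) * pairMatrix S * ((g ⊗ₖ g)ᵀ * (g ⊗ₖ g)) * pairMatrix T * (g ⊗ₖ g)ᵀ := by
        simp only [Matrix.mul_assoc]
    _ = _ := by rw [hg.kronecker_transpose_mul]; simp only [Matrix.mul_assoc, Matrix.one_mul]

lemma sqT_act {g : Mat3} (hg : IsSO3 g) (D : T4) : sqT (act g D) = act g (sqT D) :=
  compT_act hg D D

lemma cbT_act {g : Mat3} (hg : IsSO3 g) (D : T4) : cbT (act g D) = act g (cbT D) := by
  change compT (sqT (act g D)) (act g D) = _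
  rw [sqT_act hg, compT_act hg]
  rfl

/-- Contraction of a fourth-order tensor over its first and third indices. -/
noncomputable def contract13 (T : T4) : Mat3 := Matrix.of fun j l => ∑ i, T i j i l

lemma IsSO3.sum_mul {g : Mat3} (hg : IsSO3 g) (p r : Fin 3) :
    ∑ i, g i p * g i r = if p = r then 1 else 0 := by
  have := congrFun (congrFun hg.transpose_mul p) r
  simpa [Matrix.mul_apply, Matrix.one_apply] using this

lemma contract13_act {g : Mat3} (hg : IsSO3 g) (T : T4) :
    contract13 (act g T) = g * contract13 T * gᵀ := by
  ext j l
  have key : contract13 (act g T) j l = ∑ p, ∑ q, ∑ r, ∑ s,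
      (∑ i, g i p * g i r) * (g j q * g l s * T p q r s) := by
    simp only [contract13, act, Matrix.of_apply, Fin.sum_univ_three]
    ring
  rw [key]
  simp only [hg.sum_mul]
  simp only [contract13, Matrix.mul_apply, Matrix.of_apply, Matrix.transpose_apply,
    Fin.sum_univ_three]
  simp
  ring

lemma d2_act {g : Mat3} (hg : IsSO3 g) (D : T4) : d2 (act g D) = g * d2 D * gᵀ := by
  change contract13 (sqT (act g D)) = _
  rw [sqT_act hg, contract13_act hg]
  rfl

lemma d3_act {g : Mat3} (hg : IsSO3 g) (D : T4) : d3 (act g D) = g * d3 D * gᵀ := by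
  change contract13 (cbT (act g D)) = _
  rw [cbT_act hg, contract13_act hg]
  rfl

lemma IsSO3.conj_mul_conj {g : Mat3} (hg : IsSO3 g) (A B : Mat3) :
    (g * A * gᵀ) * (g * B * gᵀ) = g * (A * B) * gᵀ := by
  calc _ = g * A * (gᵀ * g) * B * gᵀ := by simp only [Matrix.mul_assoc]
    _ = _ := by rw [hg.transpose_mul]; simp [Matrix.mul_assoc]

lemma IsSO3.trace_conj {g : Mat3} (hg : IsSO3 g) (A : Mat3) : (g * A * gᵀ).trace = A.trace := by
  rw [Matrix.trace_mul_comm, ← Matrix.mul_assoc, hg.transpose_mul, Matrix.one_mul]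

/-- The bilinear form `∑ A i j T i j k l B k l` on matrices given by a fourth-order tensor. -/
noncomputable def bilin (A : Mat3) (T : T4) (B : Mat3) : ℝ :=
  ∑ i, ∑ j, ∑ k, ∑ l, A i j * T i j k l * B k l

lemma bilin_eq (A : Mat3) (T : T4) (B : Mat3) :
    bilin A T B = (fun a : Fin 3 × Fin 3 => A a.1 a.2) ⬝ᵥ
      (pairMatrix T *ᵥ fun a : Fin 3 × Fin 3 => B a.1 a.2) := by
  simp only [bilin, dotProduct, Matrix.mulVec, pairMatrix, Matrix.of_apply,
    Fintype.sum_prod_type, Fin.sum_univ_three]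
  ring

lemma kronecker_mulVec (g A : Mat3) :
    (fun a : Fin 3 × Fin 3 => (g * A * gᵀ) a.1 a.2) =
      (g ⊗ₖ g) *ᵥ fun a : Fin 3 × Fin 3 => A a.1 a.2 := by
  ext ⟨i, j⟩
  simp only [Matrix.mulVec, dotProduct, Matrix.mul_apply, Matrix.transpose_apply,
    Matrix.kroneckerMap_apply, Fintype.sum_prod_type, Fin.sum_univ_three]
  ring

lemma bilin_act {g : Mat3} (hg : IsSO3 g) (A : Mat3) (T : T4) (B : Mat3) :
    bilin (g * A * gᵀ) (act g T) (g * B * gᵀ) = bilin A T B := by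
  have h := hg.kronecker_transpose_mul
  rw [bilin_eq, bilin_eq, kronecker_mulVec, kronecker_mulVec, pairMatrix_act, Matrix.mulVec_mulVec,
    Matrix.mul_assoc, h, Matrix.mul_one, ← Matrix.mulVec_mulVec, Matrix.dotProduct_mulVec,
    ← Matrix.mulVec_transpose, Matrix.mulVec_mulVec, h, Matrix.one_mulVec]

lemma J2_act {g : Mat3} (hg : IsSO3 g) (D : T4) : J2 (act g D) = J2 D := by
  rw [J2, d2_act hg, hg.trace_conj, J2]

lemma J3_act {g : Mat3} (hg : IsSO3 g) (D : T4) : J3 (act g D) = J3 D := by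
  rw [J3, d3_act hg, hg.trace_conj, J3]

lemma J4_act {g : Mat3} (hg : IsSO3 g) (D : T4) : J4 (act g D) = J4 D := by
  rw [J4, d2_act hg, hg.conj_mul_conj, hg.trace_conj, J4]

lemma J5_act {g : Mat3} (hg : IsSO3 g) (D : T4) : J5 (act g D) = J5 D := by
  change bilin _ _ _ = bilin _ _ _
  rw [d2_act hg, bilin_act hg]

lemma J6_act {g : Mat3} (hg : IsSO3 g) (D : T4) : J6 (act g D) = J6 D := by
  rw [J6, d2_act hg, hg.conj_mul_conj, hg.conj_mul_conj, hg.trace_conj, J6]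

lemma J7_act {g : Mat3} (hg : IsSO3 g) (D : T4) : J7 (act g D) = J7 D := by
  change bilin _ _ _ = bilin _ _ _
  rw [d2_act hg, hg.conj_mul_conj, bilin_act hg]

lemma J8_act {g : Mat3} (hg : IsSO3 g) (D : T4) : J8 (act g D) = J8 D := by
  change bilin _ _ _ = bilin _ _ _
  rw [d2_act hg, hg.conj_mul_conj, sqT_act hg, bilin_act hg]

lemma J9_act {g : Mat3} (hg : IsSO3 g) (D : T4) : J9 (act g D) = J9 D := by
  change bilin _ _ _ = bilin _ _ _
  rw [d2_act hg, hg.conj_mul_conj, bilin_act hg]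

lemma J10_act {g : Mat3} (hg : IsSO3 g) (D : T4) : J10 (act g D) = J10 D := by
  change bilin _ _ _ = bilin _ _ _
  rw [d2_act hg, hg.conj_mul_conj, sqT_act hg, bilin_act hg]

lemma isHarm_act {g : Mat3} (hg : IsSO3 g) {D : T4} (hD : IsHarm D) : IsHarm (act g D) := by
  obtain ⟨h₁, h₂, h₃, h₄⟩ := hD
  refine ⟨fun i j k l => ?_, fun i j k l => ?_, fun i j k l => ?_, fun i j => ?_⟩
  · simp only [act]
    rw [Finset.sum_comm]
    refine Finset.sum_congr rfl fun q _ => Finset.sum_congr rfl fun p _ =>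
      Finset.sum_congr rfl fun r _ => Finset.sum_congr rfl fun s _ => ?_
    rw [h₁ p q]; ring
  · simp only [act]
    refine Finset.sum_congr rfl fun p _ => ?_
    rw [Finset.sum_comm]
    refine Finset.sum_congr rfl fun r _ => Finset.sum_congr rfl fun q _ =>
      Finset.sum_congr rfl fun s _ => ?_
    rw [h₂ p q]; ring
  · simp only [act]
    refine Finset.sum_congr rfl fun p _ => Finset.sum_congr rfl fun q _ => ?_
    rw [Finset.sum_comm]
    refine Finset.sum_congr rfl fun s _ => Finset.sum_congr rfl fun r _ => ?_
    rw [h₃ p q r s]; ring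
  · have key : ∑ k, act g D k k i j = ∑ p, ∑ q,
        (∑ k, g k p * g k q) * ∑ r, ∑ s, g i r * g j s * D p q r s := by
      simp only [act, Fin.sum_univ_three]
      ring
    rw [key]
    simp only [hg.sum_mul, ite_mul, one_mul, zero_mul, Finset.sum_ite_eq, Finset.mem_univ, if_true]
    rw [Finset.sum_comm]
    refine Finset.sum_eq_zero fun r _ => ?_
    rw [Finset.sum_comm]
    refine Finset.sum_eq_zero fun s _ => ?_
    rw [← Finset.mul_sum, h₄, mul_zero]

/-- The components of the transversely isotropic normal form, expressed through equalities
between indices. -/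
lemma NFti_apply (δ : ℝ) (i j k l : Fin 3) :
    NFti δ i j k l =
      if i = 2 ∧ j = 2 ∧ k = 2 ∧ l = 2 then 8 * δ
      else if (i = j ∧ k = 2 ∧ l = 2) ∨ (i = k ∧ j = 2 ∧ l = 2) ∨ (i = l ∧ j = 2 ∧ k = 2) ∨
        (j = k ∧ i = 2 ∧ l = 2) ∨ (j = l ∧ i = 2 ∧ k = 2) ∨ (k = l ∧ i = 2 ∧ j = 2) then -(4 * δ)
      else if i = 2 ∨ j = 2 ∨ k = 2 ∨ l = 2 then 0
      else if i = j ∧ j = k ∧ k = l then 3 * δ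
      else if (i = j ∧ k = l) ∨ (i = k ∧ j = l) ∨ (i = l ∧ j = k) then δ else 0 := by
  fin_cases i <;> fin_cases j <;> fin_cases k <;> fin_cases l <;> simp +decide [NFti, symT]

lemma d2_NFti (δ : ℝ) :
    d2 (NFti δ) = Matrix.diagonal ![60 * δ ^ 2, 60 * δ ^ 2, 160 * δ ^ 2] := by
  ext j l
  fin_cases j <;> fin_cases l <;>
    simp [d2, sqT, NFti_apply, Fin.sum_univ_three] <;> ring

lemma sqT_NFti (δ : ℝ) (i j : Fin 3) :
    sqT (NFti δ) i i j j = δ ^ 2 * !![26, 22, -48; 22, 26, -48; -48, -48, 96] i j := by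
  fin_cases i <;> fin_cases j <;>
    simp [sqT, NFti_apply, Fin.sum_univ_three] <;> ring

lemma bilin_diagonal (u v : Fin 3 → ℝ) (T : T4) :
    bilin (Matrix.diagonal u) T (Matrix.diagonal v) = ∑ i, ∑ k, u i * T i i k k * v k := by
  simp [bilin, Matrix.diagonal_apply]

lemma J3_NFti (δ : ℝ) : J3 (NFti δ) = 720 * δ ^ 3 := by
  simp [J3, d3, cbT, Matrix.trace, sqT, NFti_apply, Fin.sum_univ_three]
  ring

lemma J2_NFti (δ : ℝ) : J2 (NFti δ) = 280 * δ ^ 2 := by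
  rw [J2, d2_NFti]
  simp [Fin.sum_univ_three]
  ring

lemma J4_NFti (δ : ℝ) : J4 (NFti δ) = 32800 * δ ^ 4 := by
  rw [J4, d2_NFti]
  simp [Fin.sum_univ_three]
  ring

lemma J6_NFti (δ : ℝ) : J6 (NFti δ) = 4528000 * δ ^ 6 := by
  rw [J6, d2_NFti]
  simp [Fin.sum_univ_three]
  ring

lemma J5_NFti (δ : ℝ) : J5 (NFti δ) = 80000 * δ ^ 5 := by
  change bilin _ _ _ = _
  rw [d2_NFti, bilin_diagonal]
  simp [Fin.sum_univ_three, NFti_apply]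
  ring

lemma J7_NFti (δ : ℝ) : J7 (NFti δ) = 17600000 * δ ^ 7 := by
  change bilin _ _ _ = _
  rw [d2_NFti, Matrix.diagonal_mul_diagonal, bilin_diagonal]
  simp [Fin.sum_univ_three, NFti_apply]
  ring

lemma J8_NFti (δ : ℝ) : J8 (NFti δ) = 211200000 * δ ^ 8 := by
  change bilin _ _ _ = _
  rw [d2_NFti, Matrix.diagonal_mul_diagonal, bilin_diagonal]
  simp [Fin.sum_univ_three, sqT_NFti]
  ring

lemma J9_NFti (δ : ℝ) : J9 (NFti δ) = 3872000000 * δ ^ 9 := by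
  change bilin _ _ _ = _
  rw [d2_NFti, Matrix.diagonal_mul_diagonal, bilin_diagonal]
  simp [Fin.sum_univ_three, NFti_apply]
  ring

lemma J10_NFti (δ : ℝ) : J10 (NFti δ) = 46464000000 * δ ^ 10 := by
  change bilin _ _ _ = _
  rw [d2_NFti, Matrix.diagonal_mul_diagonal, bilin_diagonal]
  simp [Fin.sum_univ_three, sqT_NFti]
  ring

lemma IsHarm.J2_eq {D : T4} (hD : IsHarm D) :
    J2 D = ∑ i, ∑ j, ∑ k, ∑ l, D i j k l ^ 2 := by
  obtain ⟨h₁, h₂, h₃, -⟩ := hD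
  have hs (i j p q) : D p q i j = D i j p q := by
    rw [h₂, h₁, h₃, h₂]
  simp only [J2, d2, sqT, Matrix.trace, Matrix.diag, Matrix.of_apply]
  rw [Finset.sum_comm]
  simp only [hs, sq]

/-- The inner product of a harmonic tensor with a transversely isotropic normal form only
involves its value on the symmetry axis. -/
lemma IsHarm.sum_mul_NFti {D : T4} (hD : IsHarm D) (δ : ℝ) :
    ∑ i, ∑ j, ∑ k, ∑ l, D i j k l * NFti δ i j k l = 35 * δ * D 2 2 2 2 := by
  obtain ⟨h₁, h₂, h₃, h₄⟩ := hD
  have t₀ := h₄ 0 0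
  have t₁ := h₄ 1 1
  have t₂ := h₄ 2 2
  simp only [Fin.sum_univ_three] at t₀ t₁ t₂
  have e₁ : D 1 1 0 0 = D 0 0 1 1 := by rw [h₂, h₁, h₃, h₂]
  have e₂ : D 2 2 0 0 = D 0 0 2 2 := by rw [h₂, h₁, h₃, h₂]
  have e₃ : D 2 2 1 1 = D 1 1 2 2 := by rw [h₂, h₁, h₃, h₂]
  have f (i j) : D i j i j = D i i j j := h₂ i j i j
  have f' (i j) : D i j j i = D i i j j := by rw [h₃, h₂]
  rw [e₁, e₂] at t₀
  rw [e₃] at t₁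
  simp only [Fin.sum_univ_three, NFti_apply]
  simp [f 0 1, f 1 0, f 0 2, f 2 0, f 1 2, f 2 1, f' 0 1, f' 1 0, f' 0 2, f' 2 0, f' 1 2, f' 2 1,
    e₁, e₂, e₃]
  linear_combination 3 * δ * t₀ + 3 * δ * t₁ - 27 * δ * t₂

lemma sum_NFti_sq (δ : ℝ) : ∑ i, ∑ j, ∑ k, ∑ l, NFti δ i j k l ^ 2 = 280 * δ ^ 2 := by
  simp [Fin.sum_univ_three, NFti_apply]
  ring

/-- The equality case of the Cauchy–Schwarz inequality against a transversely isotropic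
normal form. -/
lemma IsHarm.eq_NFti {D : T4} (hD : IsHarm D) {δ : ℝ}
    (h : J2 D - 70 * δ * D 2 2 2 2 + 280 * δ ^ 2 = 0) : D = NFti δ := by
  have key : ∑ i, ∑ j, ∑ k, ∑ l, (D i j k l - NFti δ i j k l) ^ 2 = 0 := by
    have e (i j k l : Fin 3) : (D i j k l - NFti δ i j k l) ^ 2 =
        D i j k l ^ 2 - 2 * (D i j k l * NFti δ i j k l) + NFti δ i j k l ^ 2 := by ring
    simp only [e, Finset.sum_add_distrib, Finset.sum_sub_distrib, ← Finset.mul_sum]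
    rw [← hD.J2_eq, hD.sum_mul_NFti, sum_NFti_sq]
    linear_combination h
  simp only [← Fintype.sum_prod_type'] at key
  rw [Finset.sum_eq_zero_iff_of_nonneg fun _ _ => sq_nonneg _] at key
  funext i j k l
  have := key (i, j, k, l) (Finset.mem_univ _)
  exact sub_eq_zero.mp (pow_eq_zero_iff two_ne_zero |>.mp this)

lemma isHermitian_d2 {D : T4} (hD : IsHarm D) : (d2 D).IsHermitian := by
  obtain ⟨h₁, h₂, h₃, -⟩ := hD
  ext j l
  simp only [Matrix.conjTranspose_apply, star_trivial, d2, sqT, Matrix.of_apply]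
  refine Finset.sum_congr rfl fun i _ => Finset.sum_congr rfl fun p _ =>
    Finset.sum_congr rfl fun q _ => ?_
  have hs (i j p q) : D p q i j = D i j p q := by rw [h₂, h₁, h₃, h₂]
  rw [hs i l p q, hs i j p q, mul_comm]

/-- Three real numbers whose first three power sums equal `1` are `0`, `0` and `1`. -/
lemma exists_eq_single_of_powerSums {x : Fin 3 → ℝ} (h₁ : ∑ i, x i = 1) (h₂ : ∑ i, x i ^ 2 = 1)
    (h₃ : ∑ i, x i ^ 3 = 1) : ∃ i, x = Pi.single i 1 := by
  simp only [Fin.sum_univ_three] at h₁ h₂ h₃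
  have e₂ : x 0 * x 1 + x 0 * x 2 + x 1 * x 2 = 0 := by
    linear_combination (x 0 + x 1 + x 2 + 1) / 2 * h₁ - h₂ / 2
  have e₃ : x 0 * x 1 * x 2 = 0 := by
    linear_combination h₃ / 3 - (x 0 ^ 2 + x 1 ^ 2 + x 2 ^ 2) / 3 * h₁ - h₂ / 3 +
      (x 0 + x 1 + x 2) / 3 * e₂
  have hx (i) : x i = 0 ∨ x i = 1 := by
    have : x i ^ 2 * (x i - 1) = 0 := by
      have hp : (x i - x 0) * (x i - x 1) * (x i - x 2) = 0 := by fin_cases i <;> simp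
      linear_combination hp + x i ^ 2 * h₁ - x i * e₂ + e₃
    rcases mul_eq_zero.mp this with h | h
    · exact .inl (pow_eq_zero_iff two_ne_zero |>.mp h)
    · exact .inr (sub_eq_zero.mp h)
  rcases hx 0 with h0 | h0 <;> rcases hx 1 with h1 | h1 <;> rcases hx 2 with h2 | h2 <;>
    rw [h0, h1, h2] at h₁ <;> norm_num at h₁
  · exact ⟨2, by ext i; fin_cases i <;> simp [h0, h1, h2]⟩
  · exact ⟨1, by ext i; fin_cases i <;> simp [h0, h1, h2]⟩
  · exact ⟨0, by ext i; fin_cases i <;> simp [h0, h1, h2]⟩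

lemma exists_isSO3_of_orthogonal {g : Mat3} (hg : g * gᵀ = 1) :
    ∃ c : ℝ, c ^ 2 = 1 ∧ IsSO3 (c • g) := by
  have h : g.det ^ 2 = 1 := by
    have := congrArg Matrix.det hg
    rwa [Matrix.det_mul, Matrix.det_transpose, Matrix.det_one, ← sq] at this
  refine ⟨g.det, h, ?_, ?_⟩
  · rw [Matrix.transpose_smul, Matrix.smul_mul, Matrix.mul_smul, hg, smul_smul, ← sq, h, one_smul]
  · rw [Matrix.det_smul, Fintype.card_fin]
    linear_combination (g.det ^ 2 + 1) * h

/-- A symmetric matrix whose first three power traces equal `1` is the orthogonal projection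
onto a line, which some rotation maps to the third axis. -/
lemma exists_eq_vecMulVec {A : Mat3} (hA : A.IsHermitian) (h₁ : A.trace = 1)
    (h₂ : (A * A).trace = 1) (h₃ : (A * A * A).trace = 1) :
    ∃ g : Mat3, IsSO3 g ∧ A = Matrix.vecMulVec (g 2) (g 2) := by
  obtain ⟨U, hU⟩ : ∃ U : Mat3, U = hA.eigenvectorUnitary := ⟨_, rfl⟩
  have hUU : Uᵀ * U = 1 := by
    have := Unitary.coe_star_mul_self hA.eigenvectorUnitary
    rw [← hU] at this
    simpa [Matrix.star_eq_conjTranspose] using this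
  set x := hA.eigenvalues
  have hspec : A = U * Matrix.diagonal x * Uᵀ := by
    have := hA.spectral_theorem
    rw [Unitary.conjStarAlgAut_apply, ← hU] at this
    simpa [Matrix.star_eq_conjTranspose, Function.comp_def] using this
  have conj_mul (B C : Mat3) : (U * B * Uᵀ) * (U * C * Uᵀ) = U * (B * C) * Uᵀ := by
    calc _ = U * B * (Uᵀ * U) * C * Uᵀ := by simp only [Matrix.mul_assoc]
      _ = _ := by rw [hUU]; simp [Matrix.mul_assoc]
  have trace_conj (B : Mat3) : (U * B * Uᵀ).trace = B.trace := by
    rw [Matrix.trace_mul_comm, ← Matrix.mul_assoc, hUU, Matrix.one_mul]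
  obtain ⟨i, hi⟩ : ∃ i, x = Pi.single i 1 := by
    apply exists_eq_single_of_powerSums
    · rw [hspec, trace_conj] at h₁
      simpa using h₁
    · rw [hspec, conj_mul, trace_conj] at h₂
      simpa [sq] using h₂
    · rw [hspec, conj_mul, conj_mul, trace_conj] at h₃
      simpa [pow_succ] using h₃
  have hg : (Uᵀ.submatrix (Equiv.swap i 2) id) * (Uᵀ.submatrix (Equiv.swap i 2) id)ᵀ = 1 := by
    rw [Matrix.transpose_submatrix, Matrix.transpose_transpose,
      ← Matrix.submatrix_mul _ _ _ _ _ Function.bijective_id, hUU, Matrix.submatrix_one_equiv]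
  obtain ⟨c, hc, hc'⟩ := exists_isSO3_of_orthogonal hg
  refine ⟨_, hc', ?_⟩
  rw [hspec, hi]
  ext j l
  simp [Matrix.mul_apply, Matrix.diagonal_apply, Matrix.vecMulVec_apply, Pi.single_apply]
  linear_combination (-(U j i * U l i)) * hc

lemma IsHarm.bilin_self {D : T4} (hD : IsHarm D) (a b : ℝ) (g : Mat3) (i : Fin 3) :
    bilin (a • (1 : Mat3) + b • Matrix.vecMulVec (g i) (g i)) D
      (a • (1 : Mat3) + b • Matrix.vecMulVec (g i) (g i)) = b ^ 2 * act g D i i i i := by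
  obtain ⟨h₁, h₂, h₃, h₄⟩ := hD
  have h₄' (i j) : ∑ k, D i j k k = 0 := by
    rw [← h₄ i j]
    refine Finset.sum_congr rfl fun k _ => ?_
    rw [h₂, h₁, h₃, h₂]
  have key : bilin (a • (1 : Mat3) + b • Matrix.vecMulVec (g i) (g i)) D
      (a • (1 : Mat3) + b • Matrix.vecMulVec (g i) (g i)) =
      b ^ 2 * act g D i i i i + a ^ 2 * ∑ j, ∑ k, D k k j j +
        a * b * (∑ j, ∑ l, g i j * g i l * ∑ k, D k k j l) +
        a * b * (∑ j, ∑ l, g i j * g i l * ∑ k, D j l k k) := by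
    simp [bilin, act, Fin.sum_univ_three, Matrix.vecMulVec_apply, Matrix.one_apply]
    ring
  rw [key]
  simp [h₄, h₄']

lemma transverselyIsotropic_of_relations {D : T4} (hD : IsHarm D)
    (h₄ : 98 * J4 D = 41 * (J2 D) ^ 2) (h₅ : 63 * J5 D = 25 * J3 D * J2 D)
    (h₃ : 3430 * (J3 D) ^ 2 = 81 * (J2 D) ^ 3) (h₆ : 1372 * J6 D = 283 * (J2 D) ^ 3) :
    ∃ (g : Mat3) (δ : ℝ), IsSO3 g ∧ act g D = NFti δ := by
  by_cases h0 : J2 D = 0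
  · have h1 : IsSO3 1 := ⟨by simp, by simp⟩
    refine ⟨1, 0, h1, (isHarm_act h1 hD).eq_NFti ?_⟩
    rw [J2_act h1, h0]
    ring
  have t₂ : (d2 D).trace = J2 D := rfl
  have t₄ : (d2 D * d2 D).trace = J4 D := rfl
  have t₆ : (d2 D * d2 D * d2 D).trace = J6 D := rfl
  set A : Mat3 := (14 / (5 * J2 D)) • (d2 D - (3 / 14 * J2 D) • (1 : Mat3)) with hA
  have hH : A.IsHermitian :=
    ((isHermitian_d2 hD).sub (by simp [Matrix.IsHermitian])).smul (IsSelfAdjoint.all _)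
  have hA₁ : A.trace = 1 := by
    simp only [hA, Matrix.trace_smul, Matrix.trace_sub, Matrix.trace_one, t₂, smul_eq_mul,
      Fintype.card_fin]
    field_simp
    norm_num
  have hA₂ : (A * A).trace = 1 := by
    simp only [hA, Matrix.smul_mul, Matrix.mul_smul, Matrix.sub_mul, Matrix.mul_sub,
      Matrix.one_mul, Matrix.mul_one, Matrix.trace_smul, Matrix.trace_sub, Matrix.trace_one, t₂,
      t₄, smul_eq_mul, Fintype.card_fin]
    field_simp
    linear_combination 2 * h₄
  have hA₃ : (A * A * A).trace = 1 := by
    simp only [hA, Matrix.smul_mul, Matrix.mul_smul, Matrix.sub_mul, Matrix.mul_sub,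
      Matrix.one_mul, Matrix.mul_one, Matrix.trace_smul, Matrix.trace_sub, Matrix.trace_one, t₂,
      t₄, t₆, smul_eq_mul, Fintype.card_fin]
    field_simp
    linear_combination 2 * h₆ - 18 * J2 D * h₄
  obtain ⟨g, hg, hAg⟩ := exists_eq_vecMulVec hH hA₁ hA₂ hA₃
  refine ⟨g, 7 * J3 D / (18 * J2 D), hg, (isHarm_act hg hD).eq_NFti ?_⟩
  have hd : d2 D = (3 / 14 * J2 D) • (1 : Mat3) + (5 / 14 * J2 D) • vecMulVec (g 2) (g 2) := by
    have : 5 / 14 * J2 D * (14 / (5 * J2 D)) = 1 := by field_simp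
    rw [← hAg, hA, smul_smul, this, one_smul]
    abel
  have h5 : J5 D = (5 / 14 * J2 D) ^ 2 * act g D 2 2 2 2 := by
    rw [← hD.bilin_self (3 / 14 * J2 D), ← hd]
    rfl
  have hJ : act g D 2 2 2 2 = 28 / 9 * (J3 D / J2 D) := by
    rw [h5] at h₅
    field_simp
    apply mul_left_cancel₀ h0
    linear_combination (196 / 175) * h₅
  rw [J2_act hg, hJ]
  field_simp
  linear_combination (-36) * h₃

/-- a harmonic tensor `D ∈ H⁴` lies in the closed transversely isotropic
stratum iff its fundamental invariants satisfy the eight listed relations; moreover, when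
`J₂ ≠ 0`, the parameter is given by `δ = 7J₃/(18J₂)`. -/
theorem transversely_isotropic_stratum_characterization (D : T4) (hD : IsHarm D) :
    ((∃ (g : Mat3) (δ : ℝ), IsSO3 g ∧ act g D = NFti δ) ↔
      (98 * J4 D = 41 * (J2 D) ^ 2 ∧
       63 * J5 D = 25 * J3 D * J2 D ∧
       3430 * (J3 D) ^ 2 = 81 * (J2 D) ^ 3 ∧
       1372 * J6 D = 283 * (J2 D) ^ 3 ∧
       882 * J7 D = 275 * (J2 D) ^ 2 * J3 D ∧
       4802 * J8 D = 165 * (J2 D) ^ 4 ∧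
       12348 * J9 D = 3025 * (J2 D) ^ 3 * J3 D ∧
       67228 * J10 D = 1815 * (J2 D) ^ 5)) ∧
    (∀ (g : Mat3) (δ : ℝ), IsSO3 g → act g D = NFti δ → J2 D ≠ 0 →
      δ = 7 * J3 D / (18 * J2 D)) := by
  constructor
  · constructor
    · rintro ⟨g, δ, hg, h⟩
      rw [← J2_act hg, ← J3_act hg, ← J4_act hg, ← J5_act hg, ← J6_act hg, ← J7_act hg,
        ← J8_act hg, ← J9_act hg, ← J10_act hg, h, J2_NFti, J3_NFti, J4_NFti, J5_NFti, J6_NFti,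
        J7_NFti, J8_NFti, J9_NFti, J10_NFti]
      refine ⟨?_, ?_, ?_, ?_, ?_, ?_, ?_, ?_⟩ <;> ring
    · rintro ⟨h₄, h₅, h₃, h₆, -⟩
      exact transverselyIsotropic_of_relations hD h₄ h₅ h₃ h₆
  · intro g δ hg h h0
    rw [← J2_act hg, h, J2_NFti] at h0
    rw [← J2_act hg, ← J3_act hg, h, J2_NFti, J3_NFti]
    have : δ ≠ 0 := by rintro rfl; simp at h0
    field_simp
    norm_num
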